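/- Non-malleable extractors with the stated parameters exist nonconstructively: for any n, k, d, m with k > 2m + 3·log(1/ε) + log d + 9 and d > log(n − k + 1) + 2·log(1/ε) + 7, there exists a function nmExt: {0,1}^n × {0,1}^d → {0,1}^m that is a (k, ε)-non-malleable extractor. -/

import Mathlib

open Finset

noncomputable section
open scoped Classical

/-- Statistical distance between two mass functions on a finite type. -/
def SD {α : Type*} [Fintype α] (p q : α → ℝ) : ℝ := (1/2) * ∑ x, |p x - q x|

/-- `p` is a probability mass function. -/
def IsDist {α : Type*} [Fintype α] (p : α → ℝ) : Prop :=
  (∀ x, 0 ≤ p x) ∧ ∑ x, p x = 1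

variable {n d m : ℕ}

/-- `(k, ε)`-non-malleable extractor: for any source `X` with `H∞(X) ≥ k` and any
fixed-point-free adversary `𝒜` on seeds, with `Y` uniform on `{0,1}^d` independent
of `X`, `(nmExt(X,Y), nmExt(X,𝒜(Y)), Y) ≈_ε (U_m, nmExt(X,𝒜(Y)), Y)`. -/
def IsNMExt (k ε : ℝ)
    (nm : (Fin n → Bool) → (Fin d → Bool) → (Fin m → Bool)) : Prop :=
  ∀ X : (Fin n → Bool) → ℝ, IsDist X → (∀ x, X x ≤ (2:ℝ) ^ (-k)) →
    ∀ A : (Fin d → Bool) → (Fin d → Bool), (∀ y, A y ≠ y) →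
      SD (fun z : (Fin m → Bool) × (Fin m → Bool) × (Fin d → Bool) =>
            ((2:ℝ)^d)⁻¹ *
              ∑ x ∈ univ.filter (fun x => nm x z.2.2 = z.1 ∧ nm x (A z.2.2) = z.2.1), X x)
         (fun z => ((2:ℝ)^m)⁻¹ * ((2:ℝ)^d)⁻¹ *
            ∑ x ∈ univ.filter (fun x => nm x (A z.2.2) = z.2.1), X x) ≤ ε

/-- Resampling one coordinate of a function preserves sums over all functions. -/
theorem sum_sum_update {Y M : Type*} [Fintype Y] [DecidableEq Y] [Fintype M] (H : (Y → M) → ℝ) (a : Y) :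
    ∑ f : Y → M, ∑ u : M, H (Function.update f a u) = Fintype.card M * ∑ f : Y → M, H f := by
  have hinv : Function.Involutive
      (fun p : (Y → M) × M => (Function.update p.1 a p.2, p.1 a)) := by
    rintro ⟨f, u⟩
    simp
  have h := Equiv.sum_comp hinv.toPerm (fun p : (Y → M) × M => H p.1)
  rw [Fintype.sum_prod_type, Fintype.sum_prod_type] at h
  simpa [Finset.mul_sum] using h

/-- Hoeffding's lemma for a centred function with values in `[-1, 1]` on a finite type. -/
theorem sum_exp_le_of_sum_eq_zero {M : Type*} [Fintype M] (z : M → ℝ) (hz : ∀ u, |z u| ≤ 1)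
    (hsum : ∑ u, z u = 0) (μ : ℝ) :
    ∑ u, Real.exp (μ * z u) ≤ Fintype.card M * Real.exp (μ ^ 2 / 2) := by
  have hpt : ∀ u, Real.exp (μ * z u) ≤ Real.cosh μ + z u * Real.sinh μ := by
    intro u
    obtain ⟨h1, h2⟩ := abs_le.mp (hz u)
    have h := convexOn_exp.2 (Set.mem_univ μ) (Set.mem_univ (-μ))
      (show 0 ≤ (1 + z u) / 2 by linarith) (show 0 ≤ (1 - z u) / 2 by linarith) (by ring)
    simp only [smul_eq_mul] at h
    rw [Real.cosh_eq, Real.sinh_eq]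
    calc Real.exp (μ * z u) = Real.exp ((1 + z u) / 2 * μ + (1 - z u) / 2 * -μ) := by
          congr 1; ring
      _ ≤ _ := h
      _ = _ := by ring
  calc ∑ u, Real.exp (μ * z u) ≤ ∑ u, (Real.cosh μ + z u * Real.sinh μ) :=
        Finset.sum_le_sum fun u _ => hpt u
    _ = Fintype.card M * Real.cosh μ := by
        rw [Finset.sum_add_distrib, ← Finset.sum_mul, hsum]
        simp
    _ ≤ _ := by
        gcongr
        exact Real.cosh_le_exp_half_sq μ

/-- Exponential moment bound when the dependency `y ↦ A y` strictly decreases a rank function. -/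
theorem sum_exp_le_of_rank_lt {Y M : Type*} [Fintype Y] [DecidableEq Y] [Fintype M] (z : Y → M → M → ℝ)
    (hz : ∀ y u v, |z y u v| ≤ 1) (hsum : ∀ y v, ∑ u, z y u v = 0) (A : Y → Y) (r : Y → ℤ)
    (μ : ℝ) (P : Finset Y) (hP : ∀ y ∈ P, r (A y) < r y) :
    ∑ f : Y → M, Real.exp (μ * ∑ y ∈ P, z y (f y) (f (A y))) ≤
      Fintype.card (Y → M) * Real.exp (μ ^ 2 / 2 * #P) := by
  induction P using Finset.induction_on_max_value r with
  | empty => simp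
  | insert a s ha hmax ih =>
    have ih := ih fun y hy => hP y (Finset.mem_insert_of_mem hy)
    rcases isEmpty_or_nonempty M with hM | hM
    · have : Nonempty Y := ⟨a⟩
      simp
    have hAa : A a ≠ a := fun h => by
      have := hP a (Finset.mem_insert_self a s)
      rw [h] at this
      exact lt_irrefl _ this
    have hcard : (0 : ℝ) < Fintype.card M := by exact_mod_cast Fintype.card_pos
    have hupd : ∀ (f : Y → M) (u : M),
        Real.exp (μ * ∑ y ∈ insert a s,
          z y (Function.update f a u y) (Function.update f a u (A y))) =
        Real.exp (μ * ∑ y ∈ s, z y (f y) (f (A y))) * Real.exp (μ * z a u (f (A a))) := by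
      intro f u
      rw [Finset.sum_insert ha, ← Real.exp_add]
      have : ∑ y ∈ s, z y (Function.update f a u y) (Function.update f a u (A y)) =
          ∑ y ∈ s, z y (f y) (f (A y)) := by
        refine Finset.sum_congr rfl fun y hy => ?_
        have h1 : y ≠ a := fun h => ha (h ▸ hy)
        have h2 : A y ≠ a := fun h => by
          have h3 := hP y (Finset.mem_insert_of_mem hy)
          have h4 := hmax y hy
          rw [h] at h3
          omega
        rw [Function.update_of_ne h1, Function.update_of_ne h2]
      rw [this, Function.update_self, Function.update_of_ne hAa]
      congr 1
      ring
    have key := sum_sum_update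
      (fun f : Y → M => Real.exp (μ * ∑ y ∈ insert a s, z y (f y) (f (A y)))) a
    simp only [hupd] at key
    have hstep : Fintype.card M *
        ∑ f : Y → M, Real.exp (μ * ∑ y ∈ insert a s, z y (f y) (f (A y))) ≤
        Fintype.card M * (Fintype.card (Y → M) * Real.exp (μ ^ 2 / 2 * #(insert a s))) := by
      rw [← key]
      calc _ ≤ ∑ f : Y → M, Real.exp (μ * ∑ y ∈ s, z y (f y) (f (A y))) *
              (Fintype.card M * Real.exp (μ ^ 2 / 2)) := by
            refine Finset.sum_le_sum fun f _ => ?_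
            rw [← Finset.mul_sum]
            gcongr
            exact sum_exp_le_of_sum_eq_zero _ (fun u => hz a u _) (hsum a _) μ
        _ ≤ Fintype.card (Y → M) * Real.exp (μ ^ 2 / 2 * #s) *
              (Fintype.card M * Real.exp (μ ^ 2 / 2)) := by
            rw [← Finset.sum_mul]
            gcongr
        _ = _ := by
            rw [Finset.card_insert_of_notMem ha]
            push_cast
            rw [mul_add, Real.exp_add, mul_one]
            ring
    exact le_of_mul_le_mul_left hstep hcard

/-- Exponential moment bound for a fixed-point-free dependency `y ↦ A y`. -/
theorem sum_exp_le_of_fixedPointFree {Y M : Type*} [Fintype Y] [DecidableEq Y] [Fintype M] (z : Y → M → M → ℝ)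
    (hz : ∀ y u v, |z y u v| ≤ 1) (hsum : ∀ y v, ∑ u, z y u v = 0) (A : Y → Y)
    (hA : ∀ y, A y ≠ y) (μ : ℝ) :
    ∑ f : Y → M, Real.exp (μ * ∑ y, z y (f y) (f (A y))) ≤
      Fintype.card (Y → M) * Real.exp (μ ^ 2 * Fintype.card Y) := by
  let r : Y → ℤ := fun y => ((Fintype.equivFin Y y : ℕ) : ℤ)
  have hr : Function.Injective r := fun a b h => by
    have : (Fintype.equivFin Y a : ℕ) = Fintype.equivFin Y b := by exact_mod_cast (show ((Fintype.equivFin Y a : ℕ) : ℤ) = Fintype.equivFin Y b from h)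
    exact (Fintype.equivFin Y).injective (Fin.ext this)
  let P : Finset Y := univ.filter fun y => r (A y) < r y
  have h1 := sum_exp_le_of_rank_lt z hz hsum A r (2 * μ) P (by simp [P])
  have h2 := sum_exp_le_of_rank_lt z hz hsum A (fun y => -r y) (2 * μ) Pᶜ (by
    intro y hy
    have h3 : ¬ r (A y) < r y := by simpa [P] using hy
    have h4 : r (A y) ≠ r y := fun h => hA y (hr h)
    omega)
  have hsplit : ∀ f : Y → M, Real.exp (μ * ∑ y, z y (f y) (f (A y))) =
      Real.exp (μ * ∑ y ∈ P, z y (f y) (f (A y))) *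
        Real.exp (μ * ∑ y ∈ Pᶜ, z y (f y) (f (A y))) := by
    intro f
    rw [← Real.exp_add, ← mul_add, Finset.sum_add_sum_compl]
  have hsq : ∀ t : ℝ, Real.exp (μ * t) ^ 2 = Real.exp (2 * μ * t) := by
    intro t
    rw [← Real.exp_nat_mul]
    congr 1
    push_cast
    ring
  have hcs := Finset.sum_mul_sq_le_sq_mul_sq (univ : Finset (Y → M))
    (fun f => Real.exp (μ * ∑ y ∈ P, z y (f y) (f (A y))))
    (fun f => Real.exp (μ * ∑ y ∈ Pᶜ, z y (f y) (f (A y))))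
  simp only [hsq, ← hsplit] at hcs
  have hcard : (#P : ℝ) + #Pᶜ = Fintype.card Y := by
    exact_mod_cast Finset.card_add_card_compl P
  refine (pow_le_pow_iff_left₀ (by positivity) (by positivity) two_ne_zero).mp ?_
  calc _ ≤ _ := hcs
    _ ≤ _ := mul_le_mul h1 h2 (by positivity) (by positivity)
    _ = _ := by
      rw [mul_mul_mul_comm, ← Real.exp_add, mul_pow _ (Real.exp _), ← Real.exp_nat_mul _ 2, ← hcard,
        ← pow_two]
      congr 2
      push_cast
      ring

/-- A mass function bounded by `1 / K` averages `f` to at most the average of `f` over some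
`K`-element set. -/
theorem exists_card_eq_sum_mul_le {ι : Type*} [Fintype ι] (K : ℕ) (hK : 0 < K)
    (hKι : K ≤ Fintype.card ι) (X f : ι → ℝ) (hX : IsDist X) (hXK : ∀ x, X x ≤ (K : ℝ)⁻¹) :
    ∃ S ∈ powersetCard K (univ : Finset ι), ∑ x, X x * f x ≤ (K : ℝ)⁻¹ * ∑ x ∈ S, f x := by
  have hne : (powersetCard K (univ : Finset ι)).Nonempty :=
    powersetCard_nonempty.mpr (by simpa using hKι)
  obtain ⟨S, hS, hmax⟩ := Finset.exists_max_image _ (fun S => ∑ x ∈ S, f x) hne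
  refine ⟨S, hS, ?_⟩
  have hcard : #S = K := (mem_powersetCard.mp hS).2
  have hSne : S.Nonempty := card_pos.mp (by omega)
  obtain ⟨a, haS, ha⟩ := Finset.exists_min_image S f hSne
  have hout : ∀ x ∉ S, f x ≤ f a := by
    intro x hx
    have hx' : x ∉ S.erase a := fun h => hx (mem_of_mem_erase h)
    have h := hmax (insert x (S.erase a)) (mem_powersetCard.mpr ⟨subset_univ _, by
      rw [card_insert_of_notMem hx', card_erase_of_mem haS]; omega⟩)
    rw [sum_insert hx', ← Finset.add_sum_erase S f haS] at h
    linarith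
  have hKpos : (0 : ℝ) < K := by exact_mod_cast hK
  have hpt : ∀ x, X x * (f x - f a) ≤ if x ∈ S then (K : ℝ)⁻¹ * (f x - f a) else 0 := by
    intro x
    split_ifs with h
    · exact mul_le_mul_of_nonneg_right (hXK x) (sub_nonneg.mpr (ha x h))
    · exact mul_nonpos_of_nonneg_of_nonpos (hX.1 x) (sub_nonpos.mpr (hout x h))
  have h := Finset.sum_le_sum fun x (_ : x ∈ (univ : Finset ι)) => hpt x
  rw [← Finset.sum_filter, Finset.filter_mem_eq_inter, Finset.univ_inter] at h
  simp only [mul_sub, Finset.sum_sub_distrib, ← Finset.sum_mul, hX.2, Finset.sum_const, hcard,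
    nsmul_eq_mul, ← Finset.mul_sum] at h
  have : (K : ℝ) * ((K : ℝ)⁻¹ * f a) = f a := by field_simp
  linarith

theorem choose_le_exp_mul_div_pow (N K : ℕ) (hK : 0 < K) :
    (N.choose K : ℝ) ≤ (Real.exp 1 * (N / K)) ^ K := by
  have hKpos : (0 : ℝ) < K := by exact_mod_cast hK
  have h1 := Real.pow_div_factorial_le_exp (K : ℝ) hKpos.le K
  have h2 : Real.exp (K : ℝ) = Real.exp 1 ^ K := by
    rw [← Real.exp_nat_mul, mul_one]
  calc (N.choose K : ℝ) ≤ (N : ℝ) ^ K / K.factorial := Nat.choose_le_pow_div K N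
    _ = (K : ℝ) ^ K / K.factorial * (N / K) ^ K := by
        rw [div_pow]; field_simp
    _ ≤ Real.exp K * (N / K) ^ K := by gcongr
    _ = _ := by rw [h2, mul_pow]

theorem two_rpow_le_exp {t : ℝ} (ht : 0 ≤ t) : (2 : ℝ) ^ t ≤ Real.exp t := by
  rw [← Real.exp_one_rpow]
  exact Real.rpow_le_rpow (by norm_num) (by linarith [Real.add_one_le_exp 1]) ht

theorem le_floor_two_rpow (d m : ℕ) (k ε : ℝ) (hε : 0 < ε) (hε1 : ε < 1) (hd0 : 0 < d)
    (hk : k > 2 * m + 3 * Real.logb 2 (1/ε) + Real.logb 2 d + 9) :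
    256 * ((2 : ℝ) ^ m * 2 ^ m) * d ≤ ε ^ 2 * ⌊(2 : ℝ) ^ k⌋₊ ∧
      (2 : ℝ) ^ k ≤ 2 * ⌊(2 : ℝ) ^ k⌋₊ ∧ 0 < ⌊(2 : ℝ) ^ k⌋₊ := by
  have hdpos : (0 : ℝ) < d := by exact_mod_cast hd0
  have hd1 : (1 : ℝ) ≤ d := by exact_mod_cast hd0
  have hexp : (2 : ℝ) ^ (2 * m + 3 * Real.logb 2 (1/ε) + Real.logb 2 d + 9 : ℝ) =
      (2 : ℝ) ^ m * 2 ^ m * (1 / ε) ^ 3 * d * 512 := by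
    rw [Real.rpow_add two_pos, Real.rpow_add two_pos, Real.rpow_add two_pos,
      Real.rpow_logb two_pos (by norm_num) hdpos, mul_comm (3 : ℝ),
      Real.rpow_mul two_pos.le (Real.logb _ _),
      Real.rpow_logb two_pos (by norm_num) (by positivity), two_mul, Real.rpow_add two_pos,
      Real.rpow_natCast]
    norm_num
  have hlt : (2 : ℝ) ^ m * 2 ^ m * (1 / ε) ^ 3 * d * 512 < (2 : ℝ) ^ k := by
    rw [← hexp]
    exact Real.rpow_lt_rpow_of_exponent_lt one_lt_two hk
  have hinv : 1 ≤ 1 / ε := by rw [le_div_iff₀ hε]; linarith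
  have hm : (1 : ℝ) ≤ 2 ^ m := one_le_pow₀ one_le_two
  have hone : (1 : ℝ) ≤ 2 ^ m * 2 ^ m * (1 / ε) ^ 3 * d :=
    one_le_mul_of_one_le_of_one_le (one_le_mul_of_one_le_of_one_le
      (one_le_mul_of_one_le_of_one_le hm hm) (one_le_pow₀ hinv)) hd1
  have hfl := Nat.lt_floor_add_one ((2 : ℝ) ^ k)
  have hhalf : (2 : ℝ) ^ k ≤ 2 * ⌊(2 : ℝ) ^ k⌋₊ := by linarith
  refine ⟨?_, hhalf, ?_⟩
  · have h1 : (2 : ℝ) ^ m * 2 ^ m * d * 512 ≤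
        ε ^ 2 * ((2 : ℝ) ^ m * 2 ^ m * (1 / ε) ^ 3 * d * 512) := by
      have : ε ^ 2 * ((2 : ℝ) ^ m * 2 ^ m * (1 / ε) ^ 3 * d * 512) =
          (2 : ℝ) ^ m * 2 ^ m * d * 512 * (1 / ε) := by
        field_simp
      rw [this]
      exact le_mul_of_one_le_right (by positivity) hinv
    have h2 := mul_le_mul_of_nonneg_left (hlt.le.trans hhalf) (sq_nonneg ε)
    linarith
  · have : (0 : ℝ) < ⌊(2 : ℝ) ^ k⌋₊ := by linarith
    exact_mod_cast this

theorem mul_le_sq_mul_two_pow (n d : ℕ) (k ε : ℝ) (hε : 0 < ε) (hkn : k ≤ n)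
    (hd : (d : ℝ) > Real.logb 2 ((n : ℝ) - k + 1) + 2 * Real.logb 2 (1/ε) + 7) :
    128 * ((n : ℝ) - k + 1) ≤ ε ^ 2 * 2 ^ d := by
  have hpos : (0 : ℝ) < n - k + 1 := by linarith
  have hexp : (2 : ℝ) ^ (Real.logb 2 ((n : ℝ) - k + 1) + 2 * Real.logb 2 (1/ε) + 7) =
      ((n : ℝ) - k + 1) * (1 / ε) ^ 2 * 128 := by
    rw [Real.rpow_add two_pos, Real.rpow_add two_pos,
      Real.rpow_logb two_pos (by norm_num) hpos, mul_comm (2 : ℝ), Real.rpow_mul two_pos.le,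
      Real.rpow_logb two_pos (by norm_num) (by positivity)]
    norm_num
  have hlt : ((n : ℝ) - k + 1) * (1 / ε) ^ 2 * 128 < (2 : ℝ) ^ d := by
    rw [← hexp, ← Real.rpow_natCast]
    exact Real.rpow_lt_rpow_of_exponent_lt one_lt_two hd
  have h2 := mul_le_mul_of_nonneg_left hlt.le (sq_nonneg ε)
  have : ε ^ 2 * (((n : ℝ) - k + 1) * (1 / ε) ^ 2 * 128) = 128 * ((n : ℝ) - k + 1) := by
    field_simp
  linarith

/-- The number of (distinguisher, adversary, flat source) triples is small compared with the
tail bound. -/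
theorem card_mul_card_mul_choose_le (n d m : ℕ) (k ε : ℝ) (hε : 0 < ε) (hε1 : ε < 1) (hd0 : 0 < d)
    (hkn : k ≤ n)
    (hk : k > 2 * m + 3 * Real.logb 2 (1/ε) + Real.logb 2 d + 9)
    (hd : (d : ℝ) > Real.logb 2 ((n : ℝ) - k + 1) + 2 * Real.logb 2 (1/ε) + 7) :
    (2 : ℝ) ^ (2 ^ m * 2 ^ m * 2 ^ d) * ((2 : ℝ) ^ d) ^ (2 ^ d) *
      ((2 ^ n).choose ⌊(2 : ℝ) ^ k⌋₊ : ℕ) ≤ Real.exp (ε ^ 2 / 4 * ⌊(2 : ℝ) ^ k⌋₊ * 2 ^ d) := by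
  obtain ⟨hK, hhalf, hKpos⟩ := le_floor_two_rpow d m k ε hε hε1 hd0 hk
  have hD := mul_le_sq_mul_two_pow n d k ε hε hkn hd
  set K := ⌊(2 : ℝ) ^ k⌋₊
  have hd1 : (1 : ℝ) ≤ d := by exact_mod_cast hd0
  have hm : (1 : ℝ) ≤ 2 ^ m * 2 ^ m := by
    have : (1 : ℝ) ≤ 2 ^ m := one_le_pow₀ one_le_two
    exact one_le_mul_of_one_le_of_one_le this this
  have hKpos' : (0 : ℝ) < K := by exact_mod_cast hKpos
  have htwo : ∀ a : ℕ, (2 : ℝ) ^ a ≤ Real.exp a := fun a => by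
    rw [← Real.rpow_natCast]
    exact two_rpow_le_exp a.cast_nonneg
  have h1 : (2 : ℝ) ^ (2 ^ m * 2 ^ m * 2 ^ d) ≤ Real.exp (2 ^ m * 2 ^ m * 2 ^ d) := by
    exact_mod_cast htwo (2 ^ m * 2 ^ m * 2 ^ d)
  have h2 : ((2 : ℝ) ^ d) ^ (2 ^ d) ≤ Real.exp (d * 2 ^ d) := by
    rw [← pow_mul]
    exact_mod_cast htwo (d * 2 ^ d)
  have h3 : ((2 ^ n).choose K : ℝ) ≤ Real.exp ((n - k + 2) * K) := by
    have hratio : ((2 ^ n : ℕ) : ℝ) / K ≤ Real.exp (n - k + 1) := by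
      rw [div_le_iff₀ hKpos']
      have ha : (2 : ℝ) ^ ((n : ℝ) - k + 1) ≤ Real.exp (n - k + 1) :=
        two_rpow_le_exp (by linarith)
      have hb : (2 : ℝ) ^ ((n : ℝ) - k + 1) * (2 : ℝ) ^ k = 2 * 2 ^ n := by
        rw [← Real.rpow_add two_pos, show (n : ℝ) - k + 1 + k = n + 1 by ring,
          Real.rpow_add two_pos, Real.rpow_natCast, Real.rpow_one, mul_comm]
      have hc : (2 : ℝ) ^ ((n : ℝ) - k + 1) * (2 : ℝ) ^ k ≤
          Real.exp (n - k + 1) * (2 * K) := by gcongr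
      push_cast
      linarith
    calc ((2 ^ n).choose K : ℝ) ≤ (Real.exp 1 * (((2 ^ n : ℕ) : ℝ) / K)) ^ K :=
          choose_le_exp_mul_div_pow _ _ hKpos
      _ ≤ (Real.exp 1 * Real.exp (n - k + 1)) ^ K := by gcongr
      _ = _ := by
          rw [← Real.exp_add, ← Real.exp_nat_mul]
          congr 1
          ring
  calc _ ≤ Real.exp (2 ^ m * 2 ^ m * 2 ^ d) * Real.exp (d * 2 ^ d) *
        Real.exp ((n - k + 2) * K) := by gcongr
    _ = Real.exp (2 ^ m * 2 ^ m * 2 ^ d + d * 2 ^ d + (n - k + 2) * K) := by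
        rw [Real.exp_add, Real.exp_add]
    _ ≤ _ := by
        apply Real.exp_le_exp.mpr
        have e1 := mul_le_mul_of_nonneg_right hK (show (0 : ℝ) ≤ 2 ^ d by positivity)
        have e2 := mul_le_mul_of_nonneg_right hD hKpos'.le
        have e3 : (2 : ℝ) ^ m * 2 ^ m * 2 ^ d ≤ 2 ^ m * 2 ^ m * d * 2 ^ d := by
          exact mul_le_mul_of_nonneg_right (le_mul_of_one_le_right (by positivity) hd1)
            (by positivity)
        have e4 : (d : ℝ) * 2 ^ d ≤ 2 ^ m * 2 ^ m * d * 2 ^ d := by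
          gcongr
          exact le_mul_of_one_le_left (by positivity) hm
        have e5 : 0 ≤ ((n : ℝ) - k) * K := mul_nonneg (by linarith) hKpos'.le
        nlinarith [show 0 ≤ (2 : ℝ) ^ m * 2 ^ m * d * 2 ^ d by positivity]

/-- The centred advantage of the distinguisher `σ` at seed `y`, for output `u` and tampered
output `v`. -/
def advantage {Y M : Type*} [Fintype M] (σ : M × M × Y → Bool) (y : Y) (u v : M) : ℝ :=
  (1 / 2) * ((if σ (u, v, y) then 1 else -1) -
    (Fintype.card M : ℝ)⁻¹ * ∑ w, if σ (w, v, y) then (1 : ℝ) else -1)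

theorem abs_advantage_le {Y M : Type*} [Fintype M] (σ : M × M × Y → Bool) (y : Y) (u v : M) :
    |advantage σ y u v| ≤ 1 := by
  have hcard : (0 : ℝ) < Fintype.card M := by
    exact_mod_cast Fintype.card_pos_iff.mpr ⟨u⟩
  have hsign : ∀ w, |if σ (w, v, y) then (1 : ℝ) else -1| ≤ 1 := by
    intro w
    split_ifs <;> simp
  have h1 : |(Fintype.card M : ℝ)⁻¹ * ∑ w, if σ (w, v, y) then (1 : ℝ) else -1| ≤ 1 := by
    rw [abs_mul, abs_of_pos (inv_pos.mpr hcard), inv_mul_le_iff₀ hcard, mul_one]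
    calc _ ≤ ∑ w, |if σ (w, v, y) then (1 : ℝ) else -1| := Finset.abs_sum_le_sum_abs _ _
      _ ≤ ∑ _w : M, (1 : ℝ) := Finset.sum_le_sum fun w _ => hsign w
      _ = _ := by simp
  have h2 := abs_le.mp h1
  have h3 := abs_le.mp (hsign u)
  rw [advantage, abs_le]
  constructor <;> linarith

theorem sum_advantage {Y M : Type*} [Fintype M] (σ : M × M × Y → Bool) (y : Y) (v : M) :
    ∑ u, advantage σ y u v = 0 := by
  rcases isEmpty_or_nonempty M with hM | hM
  · simp
  have hcard : (Fintype.card M : ℝ) ≠ 0 := by exact_mod_cast Fintype.card_ne_zero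
  simp only [advantage, ← Finset.mul_sum, Finset.sum_sub_distrib, Finset.sum_const, card_univ,
    nsmul_eq_mul]
  field_simp
  ring

/-- Some function does well on every member of a finite family of tests whose exponential
moments are small. -/
theorem exists_forall_sum_le {ι Ω T : Type*} [Fintype ι] [DecidableEq ι] [Fintype Ω] [Nonempty Ω]
    (𝒯 : Finset T) (𝒮 : Finset (Finset ι)) (K : ℕ) (h𝒮 : ∀ S ∈ 𝒮, #S = K) (g : T → Ω → ℝ)
    (μ B t : ℝ) (hμ : 0 < μ)
    (hg : ∀ τ ∈ 𝒯, ∑ ω, Real.exp (μ * g τ ω) ≤ Fintype.card Ω * Real.exp B)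
    (hcount : (#𝒯 : ℝ) * #𝒮 * Real.exp (K * B) ≤ Real.exp (μ * t)) :
    ∃ F : ι → Ω, ∀ τ ∈ 𝒯, ∀ S ∈ 𝒮, ∑ x ∈ S, g τ (F x) ≤ t := by
  have hmoment : ∀ τ ∈ 𝒯, ∀ S ∈ 𝒮, ∑ F : ι → Ω, Real.exp (μ * ∑ x ∈ S, g τ (F x)) ≤
      Fintype.card (ι → Ω) * Real.exp (K * B) := by
    intro τ hτ S hS
    have h1 : ∀ F : ι → Ω, Real.exp (μ * ∑ x ∈ S, g τ (F x)) =
        ∏ x, if x ∈ S then Real.exp (μ * g τ (F x)) else 1 := by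
      intro F
      rw [Finset.mul_sum, Real.exp_sum, Finset.prod_ite_mem, Finset.univ_inter]
    simp only [h1]
    rw [← Fintype.prod_sum (fun x ω => if x ∈ S then Real.exp (μ * g τ ω) else 1)]
    calc _ ≤ ∏ x : ι, ((Fintype.card Ω : ℝ) * if x ∈ S then Real.exp B else 1) := by
          refine Finset.prod_le_prod (fun x _ => ?_) fun x _ => ?_
          · refine Finset.sum_nonneg fun ω _ => ?_
            split_ifs <;> positivity
          · split_ifs
            · exact hg τ hτ
            · simp
      _ = _ := by
          rw [Finset.prod_mul_distrib, Finset.prod_ite_mem, Finset.univ_inter, Finset.prod_const,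
            Finset.prod_const, h𝒮 S hS, ← Real.exp_nat_mul]
          simp
  have htotal : ∑ F : ι → Ω, ∑ τ ∈ 𝒯, ∑ S ∈ 𝒮, Real.exp (μ * ∑ x ∈ S, g τ (F x)) ≤
      ∑ _F : ι → Ω, Real.exp (μ * t) := by
    rw [Finset.sum_comm]
    calc _ = ∑ τ ∈ 𝒯, ∑ S ∈ 𝒮, ∑ F : ι → Ω, Real.exp (μ * ∑ x ∈ S, g τ (F x)) :=
          Finset.sum_congr rfl fun τ _ => Finset.sum_comm
      _ ≤ ∑ _τ ∈ 𝒯, ∑ _S ∈ 𝒮, (Fintype.card (ι → Ω) * Real.exp (K * B)) :=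
          Finset.sum_le_sum fun τ hτ => Finset.sum_le_sum fun S hS => hmoment τ hτ S hS
      _ = Fintype.card (ι → Ω) * (#𝒯 * #𝒮 * Real.exp (K * B)) := by
          simp only [Finset.sum_const, nsmul_eq_mul]
          ring
      _ ≤ Fintype.card (ι → Ω) * Real.exp (μ * t) := by gcongr
      _ = _ := by rw [Finset.sum_const, card_univ, nsmul_eq_mul]
  obtain ⟨F, -, hF⟩ := Finset.exists_le_of_sum_le univ_nonempty htotal
  refine ⟨F, fun τ hτ S hS => ?_⟩
  have h1 : Real.exp (μ * ∑ x ∈ S, g τ (F x)) ≤ Real.exp (μ * t) :=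
    calc _ ≤ ∑ S ∈ 𝒮, Real.exp (μ * ∑ x ∈ S, g τ (F x)) :=
          Finset.single_le_sum (f := fun S => Real.exp (μ * ∑ x ∈ S, g τ (F x)))
            (fun _ _ => (Real.exp_pos _).le) hS
      _ ≤ ∑ τ ∈ 𝒯, ∑ S ∈ 𝒮, Real.exp (μ * ∑ x ∈ S, g τ (F x)) :=
          Finset.single_le_sum
            (f := fun τ => ∑ S ∈ 𝒮, Real.exp (μ * ∑ x ∈ S, g τ (F x)))
            (fun _ _ => Finset.sum_nonneg fun _ _ => (Real.exp_pos _).le) hτ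
      _ ≤ _ := hF
  exact le_of_mul_le_mul_left (Real.exp_le_exp.mp h1) hμ

/-- The two mass functions compared by a non-malleable extractor differ by the average advantage
of some distinguisher. -/
theorem exists_SD_eq_sum_advantage {Xt Y M : Type*} [Fintype Xt] [Fintype Y] [Fintype M]
    [DecidableEq M] (nm : Xt → Y → M) (X : Xt → ℝ) (A : Y → Y) (c : ℝ) (hc : 0 ≤ c) :
    ∃ σ : M × M × Y → Bool,
      SD (fun z : M × M × Y =>
            c * ∑ x ∈ univ.filter (fun x => nm x z.2.2 = z.1 ∧ nm x (A z.2.2) = z.2.1), X x)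
         (fun z => (Fintype.card M : ℝ)⁻¹ * c *
            ∑ x ∈ univ.filter (fun x => nm x (A z.2.2) = z.2.1), X x) =
      c * ∑ x, X x * ∑ y, advantage σ y (nm x y) (nm x (A y)) := by
  let p : M × M × Y → ℝ := fun z =>
    ∑ x ∈ univ.filter (fun x => nm x z.2.2 = z.1 ∧ nm x (A z.2.2) = z.2.1), X x
  let q : M × M × Y → ℝ := fun z => ∑ x ∈ univ.filter (fun x => nm x (A z.2.2) = z.2.1), X x
  let σ : M × M × Y → Bool := fun z => decide (0 ≤ p z - (Fintype.card M : ℝ)⁻¹ * q z)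
  refine ⟨σ, ?_⟩
  have habs : ∀ z, |c * p z - (Fintype.card M : ℝ)⁻¹ * c * q z| =
      c * ((if σ z then (1 : ℝ) else -1) * (p z - (Fintype.card M : ℝ)⁻¹ * q z)) := by
    intro z
    rw [show c * p z - (Fintype.card M : ℝ)⁻¹ * c * q z =
      c * (p z - (Fintype.card M : ℝ)⁻¹ * q z) by ring, abs_mul, abs_of_nonneg hc]
    by_cases h : 0 ≤ p z - (Fintype.card M : ℝ)⁻¹ * q z
    · simp only [σ, h, decide_true, if_true, one_mul, abs_of_nonneg]
    · simp only [σ, h, decide_false, abs_of_neg (not_le.mp h)]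
      simp
  have hp : ∀ z, p z = ∑ x, if nm x z.2.2 = z.1 ∧ nm x (A z.2.2) = z.2.1 then X x else 0 :=
    fun z => Finset.sum_filter _ _
  have hq : ∀ z, q z = ∑ x, if nm x (A z.2.2) = z.2.1 then X x else 0 :=
    fun z => Finset.sum_filter _ _
  have hterm : ∀ s : M × M × Y → ℝ, ∑ z, s z * (p z - (Fintype.card M : ℝ)⁻¹ * q z) =
      ∑ x, X x * ∑ y, (s (nm x y, nm x (A y), y) -
        (Fintype.card M : ℝ)⁻¹ * ∑ w, s (w, nm x (A y), y)) := by
    intro s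
    have hps : ∑ z, s z * p z = ∑ x, X x * ∑ y, s (nm x y, nm x (A y), y) := by
      simp only [hp, Finset.mul_sum]
      rw [Finset.sum_comm]
      refine Finset.sum_congr rfl fun x _ => ?_
      rw [Fintype.sum_prod_type_right, Fintype.sum_prod_type_right]
      refine Finset.sum_congr rfl fun y _ => ?_
      simp [ite_and, mul_comm]
    have hqs : ∑ z, s z * q z = ∑ x, X x * ∑ y, ∑ w, s (w, nm x (A y), y) := by
      simp only [hq, Finset.mul_sum]
      rw [Finset.sum_comm]
      refine Finset.sum_congr rfl fun x _ => ?_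
      rw [Fintype.sum_prod_type_right, Fintype.sum_prod_type_right]
      refine Finset.sum_congr rfl fun y _ => ?_
      simp [mul_comm]
    simp only [mul_sub, Finset.sum_sub_distrib, mul_left_comm _ ((Fintype.card M : ℝ)⁻¹),
      ← Finset.mul_sum, hps, hqs]
  have hσ := hterm fun z => if σ z then (1 : ℝ) else -1
  change (1 / 2) * ∑ z, |c * p z - (Fintype.card M : ℝ)⁻¹ * c * q z| = _
  simp only [habs, ← Finset.mul_sum, hσ, advantage]
  simp only [mul_left_comm _ (1 / 2 : ℝ), ← Finset.mul_sum]

theorem isNMExt_of_lt {n d m : ℕ} {k ε : ℝ} (hkn : (n : ℝ) < k)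
    (nm : (Fin n → Bool) → (Fin d → Bool) → (Fin m → Bool)) : IsNMExt k ε nm := by
  intro X hX hXk
  have h1 : ∑ x, X x ≤ (2 : ℝ) ^ n * 2 ^ (-k) := by
    calc _ ≤ ∑ _x : Fin n → Bool, (2 : ℝ) ^ (-k) := Finset.sum_le_sum fun x _ => hXk x
      _ = _ := by simp
  have h2 : (2 : ℝ) ^ n * 2 ^ (-k) < 1 := by
    rw [← Real.rpow_natCast, ← Real.rpow_add two_pos]
    exact Real.rpow_lt_one_of_one_lt_of_neg one_lt_two (by linarith)
  linarith [hX.2]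

theorem isNMExt_of_forall_sum_advantage_le {n d m : ℕ} {k ε : ℝ}
    (nm : (Fin n → Bool) → (Fin d → Bool) → (Fin m → Bool))
    (h : ∀ X : (Fin n → Bool) → ℝ, IsDist X → (∀ x, X x ≤ (2 : ℝ) ^ (-k)) →
      ∀ A : (Fin d → Bool) → (Fin d → Bool), (∀ y, A y ≠ y) → ∀ σ,
        ∑ x, X x * ∑ y, advantage σ y (nm x y) (nm x (A y)) ≤ ε * 2 ^ d) :
    IsNMExt k ε nm := by
  intro X hX hXk A hA
  obtain ⟨σ, hσ⟩ := exists_SD_eq_sum_advantage nm X A ((2 : ℝ) ^ d)⁻¹ (by positivity)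
  have hcard : (Fintype.card (Fin m → Bool) : ℝ) = 2 ^ m := by simp
  rw [hcard] at hσ
  have hle : ((2 : ℝ) ^ d)⁻¹ * ∑ x, X x * ∑ y, advantage σ y (nm x y) (nm x (A y)) ≤ ε := by
    rw [inv_mul_le_iff₀ (by positivity), mul_comm]
    exact h X hX hXk A hA σ
  rw [← hσ] at hle
  convert hle

theorem isNMExt_of_one_le {n d m : ℕ} {k ε : ℝ} (hε : 1 ≤ ε)
    (nm : (Fin n → Bool) → (Fin d → Bool) → (Fin m → Bool)) : IsNMExt k ε nm := by
  refine isNMExt_of_forall_sum_advantage_le nm fun X hX _ A _ σ => ?_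
  calc _ ≤ ∑ x, X x * 2 ^ d := by
        refine Finset.sum_le_sum fun x _ => mul_le_mul_of_nonneg_left ?_ (hX.1 x)
        calc _ ≤ ∑ _y : Fin d → Bool, (1 : ℝ) :=
              Finset.sum_le_sum fun y _ => (abs_le.mp (abs_advantage_le σ y _ _)).2
          _ = _ := by simp
    _ = 2 ^ d := by rw [← Finset.sum_mul, hX.2, one_mul]
    _ ≤ _ := le_mul_of_one_le_left (by positivity) hε

/-- non-malleable extractors exist (nonconstructively) whenever
`k > 2m + 3·log₂(1/ε) + log₂ d + 9` and `d > log₂(n - k + 1) + 2·log₂(1/ε) + 7`. -/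
theorem nm_extractor_exists
    (n d m : ℕ) (k ε : ℝ) (hε : 0 < ε)
    (hk : k > 2 * m + 3 * Real.logb 2 (1/ε) + Real.logb 2 d + 9)
    (hd : (d : ℝ) > Real.logb 2 ((n : ℝ) - k + 1) + 2 * Real.logb 2 (1/ε) + 7) :
    ∃ nm : (Fin n → Bool) → (Fin d → Bool) → (Fin m → Bool), IsNMExt k ε nm := by
  let z : (Fin n → Bool) → (Fin d → Bool) → (Fin m → Bool) := fun _ _ _ => false
  rcases le_or_gt 1 ε with hε1 | hε1
  · exact ⟨z, isNMExt_of_one_le hε1 z⟩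
  rcases lt_or_ge (n : ℝ) k with hkn | hkn
  · exact ⟨z, isNMExt_of_lt hkn z⟩
  rcases Nat.eq_zero_or_pos d with hd0 | hd0
  · subst hd0
    exact ⟨z, fun X _ _ A hA => absurd (Subsingleton.elim _ _) (hA default)⟩
  have hcount := card_mul_card_mul_choose_le n d m k ε hε hε1 hd0 hkn hk hd
  obtain ⟨-, -, hKpos⟩ := le_floor_two_rpow d m k ε hε hε1 hd0 hk
  have hKle : (⌊(2 : ℝ) ^ k⌋₊ : ℝ) ≤ 2 ^ k := Nat.floor_le (by positivity)
  set K := ⌊(2 : ℝ) ^ k⌋₊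
  have hKpos' : (0 : ℝ) < K := by exact_mod_cast hKpos
  have hKn : K ≤ Fintype.card (Fin n → Bool) := by
    have h : (K : ℝ) ≤ 2 ^ n := hKle.trans (by
      rw [← Real.rpow_natCast]
      exact Real.rpow_le_rpow_of_exponent_le one_le_two hkn)
    simpa using (by exact_mod_cast h : K ≤ 2 ^ n)
  let pairs : Finset ((((Fin m → Bool) × (Fin m → Bool) × (Fin d → Bool)) → Bool) ×
      ((Fin d → Bool) → (Fin d → Bool))) := univ.filter fun τ => ∀ y, τ.2 y ≠ y
  have hpairs : (#pairs : ℝ) ≤ 2 ^ (2 ^ m * 2 ^ m * 2 ^ d) * ((2 : ℝ) ^ d) ^ (2 ^ d) := by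
    have h := Finset.card_le_univ pairs
    simp only [Fintype.card_prod, Fintype.card_fun, Fintype.card_bool, Fintype.card_fin,
      ← mul_assoc] at h
    exact_mod_cast h
  obtain ⟨nm, hnm⟩ := exists_forall_sum_le pairs
    (powersetCard K (univ : Finset (Fin n → Bool))) K (fun S hS => (mem_powersetCard.mp hS).2)
    (fun τ (f : (Fin d → Bool) → (Fin m → Bool)) => ∑ y, advantage τ.1 y (f y) (f (τ.2 y)))
    (ε / 2) ((ε / 2) ^ 2 * 2 ^ d) (ε * K * 2 ^ d) (by positivity)
    (fun τ hτ => by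
      have h := sum_exp_le_of_fixedPointFree (advantage τ.1) (abs_advantage_le τ.1)
        (sum_advantage τ.1) τ.2 (mem_filter.mp hτ).2 (ε / 2)
      simpa using h)
    (by
      have hchoose : #(powersetCard K (univ : Finset (Fin n → Bool))) = (2 ^ n).choose K := by
        simp
      rw [hchoose]
      calc _ ≤ Real.exp (ε ^ 2 / 4 * K * 2 ^ d) * Real.exp (K * ((ε / 2) ^ 2 * 2 ^ d)) := by
            refine mul_le_mul_of_nonneg_right (le_trans ?_ hcount) (Real.exp_pos _).le
            gcongr
        _ = _ := by
            rw [← Real.exp_add]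
            congr 1
            ring)
  refine ⟨nm, isNMExt_of_forall_sum_advantage_le nm fun X hX hXk A hA σ => ?_⟩
  obtain ⟨S, hS, hle⟩ := exists_card_eq_sum_mul_le K hKpos hKn X
    (fun x => ∑ y, advantage σ y (nm x y) (nm x (A y))) hX (fun x => (hXk x).trans (by
      rw [Real.rpow_neg two_pos.le]
      exact inv_anti₀ hKpos' hKle))
  refine hle.trans ?_
  rw [inv_mul_le_iff₀ hKpos']
  have h := hnm (σ, A) (mem_filter.mpr ⟨mem_univ _, hA⟩) S hS
  calc _ ≤ _ := h
    _ = _ := by ring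

end
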